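/- There is a universal constant C > 0 such that the following holds. Let d, s, n ∈ ℕ, let M ≥ 0 be an integer, set Φ = 2^M, and let X ⊂ [0,Φ]^d be a finite set such that ‖x−y‖₁ ≥ 1 for all distinct x, y ∈ X and ‖x−y‖₁ ≤ Φ for all x, y ∈ X. Let μ₁, …, μ_n and ν be distributions on X, each with support of size at most s. Let σ ∈ ℝ^d be random with i.i.d. coordinates uniformly distributed on [0, Φ]. Then with probability at least 0.99 over σ, every index i' minimizing W_{T_σ}(μ_{i'}, ν) over i = 1,…,n satisfies W₁(μ_{i'}, ν) ≤ C·(1 + ln(min(s·n, |X|)))·(M+1)·min_{1≤i≤n} W₁(μ_i, ν). (This is the Quadtree nearest-neighbor approximation guarantee: the Quadtree nearest neighbor is an O(log(min(sn,|X|))·log Φ)-approximate nearest neighbor in W₁.) -/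

import Mathlib

open MeasureTheory
open scoped Classical

/-- The uniform probability measure on the interval `[0, t]`. -/
noncomputable def unif (t : ℝ) : Measure ℝ :=
  (ENNReal.ofReal t)⁻¹ • volume.restrict (Set.Icc 0 t)

/-- `x` and `y` are separated at level `ℓ` under the shift `σ`: some coordinate of their
grid cells of side `2^ℓ` (after shifting by `σ`) differs. -/
def Separated (d : ℕ) (σ : Fin d → ℝ) (ℓ : ℤ) (x y : Fin d → ℝ) : Prop :=
  ∃ i, ⌊(x i + σ i) / (2 : ℝ) ^ ℓ⌋ ≠ ⌊(y i + σ i) / (2 : ℝ) ^ ℓ⌋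

/-- The quadtree distance `T_σ(x,y) = 2 ⬝ Σ_{ℓ ≤ M} 2^ℓ ⬝ 1[x, y separated at level ℓ]`. -/
noncomputable def quadDist (d : ℕ) (M : ℤ) (σ x y : Fin d → ℝ) : ℝ :=
  2 * ∑' ℓ : ℤ, if ℓ ≤ M ∧ Separated d σ ℓ x y then (2 : ℝ) ^ ℓ else 0

/-- `μ` is a probability distribution supported on the finite set `X`. -/
def IsDistOn {α : Type*} (X : Finset α) (μ : α → ℝ) : Prop :=
  (∀ a, 0 ≤ μ a) ∧ (∀ a, μ a ≠ 0 → a ∈ X) ∧ ∑ a ∈ X, μ a = 1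

/-- `τ` is a coupling of the distributions `μ` and `ν`, supported on `X × X`. -/
def IsCouplingOn {α : Type*} (X : Finset α) (μ ν : α → ℝ) (τ : α → α → ℝ) : Prop :=
  (∀ a b, 0 ≤ τ a b) ∧ (∀ a b, τ a b ≠ 0 → a ∈ X ∧ b ∈ X) ∧
    (∀ a, ∑ b ∈ X, τ a b = μ a) ∧ (∀ b, ∑ a ∈ X, τ a b = ν b)

/-- The optimal transport cost `W_c(μ,ν)` for distributions on the finite set `X`:
the minimum of `Σ_{x,y} τ(x,y)·c(x,y)` over all couplings `τ` of `(μ,ν)`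
(expressed as an infimum; it is attained by compactness). -/
noncomputable def WOn {α : Type*} (X : Finset α) (c : α → α → ℝ) (μ ν : α → ℝ) : ℝ :=
  sInf {v | ∃ τ, IsCouplingOn X μ ν τ ∧ v = ∑ a ∈ X, ∑ b ∈ X, τ a b * c a b}

lemma isProbabilityMeasure_unif {t : ℝ} (ht : 0 < t) : IsProbabilityMeasure (unif t) := by
  constructor
  simp only [unif, Measure.smul_apply, Measure.restrict_apply MeasurableSet.univ, Set.univ_inter,
    Real.volume_Icc, sub_zero, smul_eq_mul]
  exact ENNReal.inv_mul_cancel (by simpa using ht) ENNReal.ofReal_ne_top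

lemma integral_unif {t : ℝ} (ht : 0 < t) (f : ℝ → ℝ) :
    ∫ s, f s ∂unif t = t⁻¹ * ∫ s in (0 : ℝ)..t, f s := by
  rw [unif, integral_smul_measure, intervalIntegral.integral_of_le ht.le,
    integral_Icc_eq_integral_Ioc, ENNReal.toReal_inv, ENNReal.toReal_ofReal ht.le, smul_eq_mul]

lemma integrable_fract_unif {t : ℝ} (ht : 0 < t) (x w : ℝ) :
    Integrable (fun s => Int.fract ((x + s) / w)) (unif t) := by
  have := isProbabilityMeasure_unif ht
  refine Integrable.of_bound (C := 1)
    (measurable_fract.comp (by fun_prop)).aestronglyMeasurable (.of_forall fun s => ?_)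
  rw [Real.norm_eq_abs, abs_of_nonneg (Int.fract_nonneg _)]
  exact (Int.fract_lt_one _).le

/-- A shift uniform over a whole number of periods makes the mean fractional part independent of
the point. -/
lemma integral_fract_unif {t w : ℝ} (hw : 0 < w) (N : ℕ) (hN : t = N * w) (ht : 0 < t) (x : ℝ) :
    ∫ s, Int.fract ((x + s) / w) ∂unif t = ∫ s, Int.fract (s / w) ∂unif t := by
  have hper : Function.Periodic (fun s : ℝ => Int.fract (s / w)) t := by
    intro s
    have : (s + t) / w = s / w + N := by rw [hN]; field_simp
    simp only [this, Int.fract_add_natCast]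
  rw [integral_unif ht, integral_unif ht,
    intervalIntegral.integral_comp_add_left (fun s => Int.fract (s / w)) x]
  have := hper.intervalIntegral_add_eq x 0
  simp only [zero_add] at this
  rw [add_zero, this]

lemma integral_floor_sub_floor_unif {t w : ℝ} (hw : 0 < w) (N : ℕ) (hN : t = N * w) (ht : 0 < t)
    (x y : ℝ) :
    Integrable (fun s => ((⌊(y + s) / w⌋ - ⌊(x + s) / w⌋ : ℤ) : ℝ)) (unif t) ∧
    ∫ s, ((⌊(y + s) / w⌋ - ⌊(x + s) / w⌋ : ℤ) : ℝ) ∂unif t = (y - x) / w := by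
  have := isProbabilityMeasure_unif ht
  have heq : (fun s => ((⌊(y + s) / w⌋ - ⌊(x + s) / w⌋ : ℤ) : ℝ)) =
      fun s => (y - x) / w - (Int.fract ((y + s) / w) - Int.fract ((x + s) / w)) := by
    funext s
    push_cast
    rw [Int.fract, Int.fract]
    ring
  have hy := integrable_fract_unif ht y w
  have hx := integrable_fract_unif ht x w
  have hd : Integrable
      (fun s => Int.fract ((y + s) / w) - Int.fract ((x + s) / w)) (unif t) := hy.sub hx
  rw [heq]
  refine ⟨(integrable_const _).sub hd, ?_⟩
  rw [integral_sub (integrable_const _) hd, integral_sub hy hx,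
    integral_fract_unif hw N hN ht, integral_fract_unif hw N hN ht]
  simp

lemma measurableSet_floor_eq (x y w : ℝ) :
    MeasurableSet {s : ℝ | ⌊(x + s) / w⌋ = ⌊(y + s) / w⌋} :=
  measurableSet_eq_fun (by fun_prop) (by fun_prop)

lemma unif_real_floor_ne_le {t w : ℝ} (hw : 0 < w) (N : ℕ) (hN : t = N * w) (ht : 0 < t)
    (x y : ℝ) :
    (unif t).real {s | ⌊(x + s) / w⌋ ≠ ⌊(y + s) / w⌋} ≤ |x - y| / w := by
  wlog hxy : x ≤ y generalizing x y
  · rw [abs_sub_comm]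
    simpa only [ne_comm] using this y x (le_of_not_ge hxy)
  have := isProbabilityMeasure_unif ht
  obtain ⟨hfi, hval⟩ := integral_floor_sub_floor_unif hw N hN ht x y
  have hS : MeasurableSet {s : ℝ | ⌊(x + s) / w⌋ ≠ ⌊(y + s) / w⌋} :=
    (measurableSet_floor_eq x y w).compl
  rw [abs_sub_comm, abs_of_nonneg (sub_nonneg.2 hxy), ← hval, ← integral_indicator_one hS]
  refine integral_mono ((integrable_const _).indicator hS) hfi fun s => ?_
  have hle : ⌊(x + s) / w⌋ ≤ ⌊(y + s) / w⌋ := Int.floor_le_floor (by gcongr)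
  by_cases h : ⌊(x + s) / w⌋ = ⌊(y + s) / w⌋
  · simp [h]
  · have : 1 ≤ ⌊(y + s) / w⌋ - ⌊(x + s) / w⌋ := by omega
    simpa [Set.indicator, h] using (by exact_mod_cast this : (1 : ℝ) ≤ _)

lemma unif_real_floor_eq_le {t w : ℝ} (hw : 0 < w) (N : ℕ) (hN : t = N * w) (ht : 0 < t)
    (x y : ℝ) :
    (unif t).real {s | ⌊(x + s) / w⌋ = ⌊(y + s) / w⌋} ≤ Real.exp (-(|x - y| / w)) := by
  wlog hxy : x ≤ y generalizing x y
  · rw [abs_sub_comm]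
    simpa only [eq_comm] using this y x (le_of_not_ge hxy)
  have := isProbabilityMeasure_unif ht
  obtain ⟨hfi, hval⟩ := integral_floor_sub_floor_unif hw N hN ht x y
  have hS := measurableSet_floor_eq x y w
  rw [abs_sub_comm, abs_of_nonneg (sub_nonneg.2 hxy)]
  rcases le_or_gt 1 ((y - x) / w) with h1 | h1
  · have : {s : ℝ | ⌊(x + s) / w⌋ = ⌊(y + s) / w⌋} = ∅ := by
      refine Set.eq_empty_of_forall_notMem fun s hs => ?_
      have : (x + s) / w + 1 ≤ (y + s) / w := by
        have : (y + s) / w = (x + s) / w + (y - x) / w := by ring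
        linarith
      have := Int.floor_le_floor this
      rw [Int.floor_add_one] at this
      have hs' : ⌊(x + s) / w⌋ = ⌊(y + s) / w⌋ := hs
      omega
    rw [this]
    simpa using (Real.exp_pos _).le
  · refine le_trans ?_ (Real.one_sub_le_exp_neg _)
    have h2 : ∫ s, (1 - ((⌊(y + s) / w⌋ - ⌊(x + s) / w⌋ : ℤ) : ℝ)) ∂unif t = 1 - (y - x) / w := by
      rw [integral_sub (integrable_const _) hfi, hval]
      simp
    rw [← h2, ← integral_indicator_one hS]
    refine integral_mono ((integrable_const _).indicator hS) ((integrable_const _).sub hfi)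
      fun s => ?_
    by_cases h : ⌊(x + s) / w⌋ = ⌊(y + s) / w⌋
    · simp [h]
    · have h3 : (y + s) / w ≤ (x + s) / w + 1 := by
        have : (y + s) / w = (x + s) / w + (y - x) / w := by ring
        linarith
      have h4 := Int.floor_le_floor h3
      rw [Int.floor_add_one] at h4
      have : ⌊(y + s) / w⌋ - ⌊(x + s) / w⌋ ≤ 1 := by omega
      have : ((⌊(y + s) / w⌋ - ⌊(x + s) / w⌋ : ℤ) : ℝ) ≤ 1 := by exact_mod_cast this
      simpa [Set.indicator, h] using this

lemma exists_natCast_mul_zpow {M ℓ : ℤ} (h : ℓ ≤ M) : ∃ N : ℕ, (2 : ℝ) ^ M = N * (2 : ℝ) ^ ℓ := by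
  refine ⟨2 ^ (M - ℓ).toNat, ?_⟩
  have : ((2 ^ (M - ℓ).toNat : ℕ) : ℝ) = (2 : ℝ) ^ (M - ℓ) := by
    rw [Nat.cast_pow, ← zpow_natCast, Int.toNat_of_nonneg (by omega)]
    norm_num
  rw [this, ← zpow_add₀ two_ne_zero, sub_add_cancel]

/-- The law of the random shift. -/
noncomputable abbrev shiftMeasure (d : ℕ) (M : ℤ) : Measure (Fin d → ℝ) :=
  Measure.pi fun _ : Fin d => unif ((2 : ℝ) ^ M)

instance (M : ℤ) : IsProbabilityMeasure (unif ((2 : ℝ) ^ M)) :=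
  isProbabilityMeasure_unif (by positivity)

lemma measurableSet_separated (d : ℕ) (ℓ : ℤ) (x y : Fin d → ℝ) :
    MeasurableSet {σ | Separated d σ ℓ x y} := by
  have : {σ | Separated d σ ℓ x y} = ⋃ i, Function.eval i ⁻¹'
      {s : ℝ | ⌊(x i + s) / (2 : ℝ) ^ ℓ⌋ = ⌊(y i + s) / (2 : ℝ) ^ ℓ⌋}ᶜ := by
    ext σ
    simp [Separated]
  rw [this]
  exact .iUnion fun i => measurable_pi_apply i (measurableSet_floor_eq _ _ _).compl

lemma shiftMeasure_real_separated_le {d : ℕ} {M ℓ : ℤ} (h : ℓ ≤ M) (x y : Fin d → ℝ) :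
    (shiftMeasure d M).real {σ | Separated d σ ℓ x y} ≤ (∑ i, |x i - y i|) / (2 : ℝ) ^ ℓ := by
  obtain ⟨N, hN⟩ := exists_natCast_mul_zpow h
  have hset : {σ | Separated d σ ℓ x y} = ⋃ i ∈ Finset.univ, Function.eval i ⁻¹'
      {s : ℝ | ⌊(x i + s) / (2 : ℝ) ^ ℓ⌋ ≠ ⌊(y i + s) / (2 : ℝ) ^ ℓ⌋} := by
    ext σ
    simp [Separated]
  rw [hset, Finset.sum_div]
  refine (measureReal_biUnion_finset_le _ _).trans (Finset.sum_le_sum fun i _ => ?_)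
  refine ((measurePreserving_eval (fun _ : Fin d => unif ((2 : ℝ) ^ M)) i).measureReal_preimage
    (measurableSet_floor_eq _ _ _).compl.nullMeasurableSet).trans_le ?_
  exact unif_real_floor_ne_le (by positivity) N hN (by positivity) _ _

lemma shiftMeasure_real_not_separated_le {d : ℕ} {M ℓ : ℤ} (h : ℓ ≤ M) (x y : Fin d → ℝ) :
    (shiftMeasure d M).real {σ | ¬ Separated d σ ℓ x y} ≤
      Real.exp (-((∑ i, |x i - y i|) / (2 : ℝ) ^ ℓ)) := by
  obtain ⟨N, hN⟩ := exists_natCast_mul_zpow h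
  have hset : {σ | ¬ Separated d σ ℓ x y} = Set.univ.pi fun i =>
      {s : ℝ | ⌊(x i + s) / (2 : ℝ) ^ ℓ⌋ = ⌊(y i + s) / (2 : ℝ) ^ ℓ⌋} := by
    ext σ
    simp [Separated]
  rw [hset, Measure.real, Measure.pi_pi, ENNReal.toReal_prod, Finset.sum_div,
    ← Finset.sum_neg_distrib, Real.exp_sum]
  exact Finset.prod_le_prod (fun _ _ => ENNReal.toReal_nonneg) fun i _ =>
    unif_real_floor_eq_le (by positivity) N hN (by positivity) _ _

lemma hasSum_two_zpow_nonpos : HasSum (fun ℓ : ℤ => if ℓ ≤ 0 then (2 : ℝ) ^ ℓ else 0) 2 := by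
  have hsum := HasSum.of_nat_of_neg_add_one (f := fun ℓ : ℤ => if ℓ ≤ 0 then (2 : ℝ) ^ ℓ else 0)
    (m := 1) (m' := 1) ?_ ?_
  · rwa [one_add_one_eq_two] at hsum
  · convert hasSum_single (f := fun n : ℕ => if (n : ℤ) ≤ 0 then (2 : ℝ) ^ (n : ℤ) else 0) 0
      fun n hn => if_neg (by omega)
    norm_num
  · convert hasSum_geometric_two' 1 using 2 with n
    rw [if_pos (by omega), zpow_neg, zpow_add_one₀ two_ne_zero, zpow_natCast]
    field_simp

lemma summable_quadDist_and_tsum_le {d : ℕ} {M : ℤ} (σ x y : Fin d → ℝ) :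
    Summable (fun ℓ : ℤ => if ℓ ≤ M ∧ Separated d σ ℓ x y then (2 : ℝ) ^ ℓ else 0) ∧
    ∑' ℓ : ℤ, (if ℓ ≤ M ∧ Separated d σ ℓ x y then (2 : ℝ) ^ ℓ else 0) ≤
      2 + ∑ ℓ ∈ Finset.Icc 1 M, if Separated d σ ℓ x y then (2 : ℝ) ^ ℓ else 0 := by
  have hfin : HasSum (fun ℓ : ℤ => if ℓ ∈ Finset.Icc 1 M then
      (if Separated d σ ℓ x y then (2 : ℝ) ^ ℓ else 0) else 0)
      (∑ ℓ ∈ Finset.Icc 1 M, if Separated d σ ℓ x y then (2 : ℝ) ^ ℓ else 0) := by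
    rw [← Finset.sum_congr rfl fun ℓ hℓ => if_pos hℓ]
    exact hasSum_sum_of_ne_finset_zero fun ℓ hℓ => if_neg hℓ
  have hsum := hasSum_two_zpow_nonpos.add hfin
  have hpos (ℓ : ℤ) : (0 : ℝ) < 2 ^ ℓ := by positivity
  have hle (ℓ : ℤ) : (if ℓ ≤ M ∧ Separated d σ ℓ x y then (2 : ℝ) ^ ℓ else 0) ≤
      (if ℓ ≤ 0 then (2 : ℝ) ^ ℓ else 0) + if ℓ ∈ Finset.Icc 1 M then
        (if Separated d σ ℓ x y then (2 : ℝ) ^ ℓ else 0) else 0 := by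
    have := hpos ℓ
    have hmem : ℓ ∈ Finset.Icc 1 M ↔ 1 ≤ ℓ ∧ ℓ ≤ M := Finset.mem_Icc
    have : ¬ ℓ ≤ 0 → 1 ≤ ℓ := by omega
    split_ifs <;> first | linarith | (exfalso; tauto)
  have hs : Summable (fun ℓ : ℤ => if ℓ ≤ M ∧ Separated d σ ℓ x y then (2 : ℝ) ^ ℓ else 0) :=
    Summable.of_nonneg_of_le (fun ℓ => by split_ifs <;> positivity) hle hsum.summable
  exact ⟨hs, (hs.tsum_le_tsum hle hsum.summable).trans_eq hsum.tsum_eq⟩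

lemma quadDist_nonneg {d : ℕ} (M : ℤ) (σ x y : Fin d → ℝ) : 0 ≤ quadDist d M σ x y :=
  mul_nonneg two_pos.le (tsum_nonneg fun ℓ => by split_ifs <;> positivity)

lemma quadDist_self {d : ℕ} (M : ℤ) (σ x : Fin d → ℝ) : quadDist d M σ x x = 0 := by
  simp [quadDist, Separated]

lemma le_quadDist_of_separated {d : ℕ} {M ℓ : ℤ} (h : ℓ ≤ M) {σ x y : Fin d → ℝ}
    (hs : Separated d σ ℓ x y) : 2 * (2 : ℝ) ^ ℓ ≤ quadDist d M σ x y := by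
  refine mul_le_mul_of_nonneg_left ?_ two_pos.le
  have := (summable_quadDist_and_tsum_le (M := M) σ x y).1.le_tsum ℓ
    fun j _ => by split_ifs <;> positivity
  rwa [if_pos ⟨h, hs⟩] at this

lemma quadDist_le {d : ℕ} (M : ℤ) (σ x y : Fin d → ℝ) :
    quadDist d M σ x y ≤
      4 + 2 * ∑ ℓ ∈ Finset.Icc 1 M, if Separated d σ ℓ x y then (2 : ℝ) ^ ℓ else 0 := by
  have := (summable_quadDist_and_tsum_le (M := M) σ x y).2
  rw [quadDist]
  linarith

section Couplings

variable {α : Type*} {X : Finset α} {μ ν : α → ℝ}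

lemma IsDistOn.isCouplingOn_mul (hμ : IsDistOn X μ) (hν : IsDistOn X ν) :
    IsCouplingOn X μ ν fun a b => μ a * ν b := by
  refine ⟨fun a b => mul_nonneg (hμ.1 a) (hν.1 b), fun a b h => ?_, fun a => ?_, fun b => ?_⟩
  · exact ⟨hμ.2.1 a (left_ne_zero_of_mul h), hν.2.1 b (right_ne_zero_of_mul h)⟩
  · rw [← Finset.mul_sum, hν.2.2, mul_one]
  · rw [← Finset.sum_mul, hμ.2.2, one_mul]

lemma IsCouplingOn.le_left {τ : α → α → ℝ} (h : IsCouplingOn X μ ν τ) (a b : α) :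
    τ a b ≤ μ a := by
  rw [← h.2.2.1 a]
  by_cases hb : b ∈ X
  · exact Finset.single_le_sum (f := τ a) (fun b _ => h.1 a b) hb
  · rw [not_not.1 fun h0 => hb (h.2.1 a b h0).2]
    exact Finset.sum_nonneg fun b _ => h.1 a b

lemma IsCouplingOn.le_right {τ : α → α → ℝ} (h : IsCouplingOn X μ ν τ) (a b : α) :
    τ a b ≤ ν b := by
  rw [← h.2.2.2 b]
  by_cases ha : a ∈ X
  · exact Finset.single_le_sum (f := fun a => τ a b) (fun a _ => h.1 a b) ha
  · rw [not_not.1 fun h0 => ha (h.2.1 a b h0).1]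
    exact Finset.sum_nonneg fun a _ => h.1 a b

lemma isCompact_setOf_isCouplingOn (X : Finset α) (μ ν : α → ℝ) :
    IsCompact {τ : α → α → ℝ | IsCouplingOn X μ ν τ} := by
  have hcont (a b : α) : Continuous fun τ : α → α → ℝ => τ a b := by fun_prop
  have hK : IsCompact (Set.univ.pi fun a : α => Set.univ.pi fun _ : α => Set.Icc 0 (μ a)) :=
    isCompact_univ_pi fun a => isCompact_univ_pi fun _ => isCompact_Icc
  refine hK.of_isClosed_subset ?_ fun τ hτ a _ b _ => ⟨hτ.1 a b, hτ.le_left a b⟩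
  have hset : {τ : α → α → ℝ | IsCouplingOn X μ ν τ} =
      (⋂ a, ⋂ b, {τ | 0 ≤ τ a b}) ∩ ((⋂ a, ⋂ b, {τ | ¬ (a ∈ X ∧ b ∈ X) → τ a b = 0}) ∩
        ((⋂ a, {τ | ∑ b ∈ X, τ a b = μ a}) ∩ ⋂ b, {τ | ∑ a ∈ X, τ a b = ν b})) := by
    ext τ
    simp only [IsCouplingOn, Set.mem_ofPred_eq, Set.mem_inter_iff, Set.mem_iInter, ne_eq,
      not_imp_comm]
  rw [hset]
  refine .inter (isClosed_iInter fun a => isClosed_iInter fun b =>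
    isClosed_le continuous_const (hcont a b)) (.inter (isClosed_iInter fun a => isClosed_iInter
    fun b => ?_) (.inter (isClosed_iInter fun a => ?_) (isClosed_iInter fun b => ?_)))
  · by_cases h : a ∈ X ∧ b ∈ X
    · simp [h]
    · simpa only [h, not_false_eq_true, forall_const] using
        isClosed_eq (hcont a b) continuous_const
  · exact isClosed_eq (by fun_prop) continuous_const
  · exact isClosed_eq (by fun_prop) continuous_const

lemma IsCouplingOn.wOn_le {τ : α → α → ℝ} {c : α → α → ℝ} (hc : ∀ a b, 0 ≤ c a b)
    (hτ : IsCouplingOn X μ ν τ) : WOn X c μ ν ≤ ∑ a ∈ X, ∑ b ∈ X, τ a b * c a b := by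
  refine csInf_le ⟨0, ?_⟩ ⟨τ, hτ, rfl⟩
  rintro _ ⟨τ', hτ', rfl⟩
  exact Finset.sum_nonneg fun a _ => Finset.sum_nonneg fun b _ => mul_nonneg (hτ'.1 a b) (hc a b)

lemma exists_isCouplingOn_eq_wOn {c : α → α → ℝ} (hc : ∀ a b, 0 ≤ c a b)
    (hμ : IsDistOn X μ) (hν : IsDistOn X ν) :
    ∃ τ, IsCouplingOn X μ ν τ ∧ ∑ a ∈ X, ∑ b ∈ X, τ a b * c a b = WOn X c μ ν := by
  obtain ⟨τ, hτ, hmin⟩ := (isCompact_setOf_isCouplingOn X μ ν).exists_isMinOn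
    ⟨_, hμ.isCouplingOn_mul hν⟩
    (f := fun τ => ∑ a ∈ X, ∑ b ∈ X, τ a b * c a b) (by fun_prop)
  refine ⟨τ, hτ, le_antisymm (le_csInf ⟨_, τ, hτ, rfl⟩ ?_) (hτ.wOn_le hc)⟩
  rintro _ ⟨τ', hτ', rfl⟩
  exact hmin hτ'

end Couplings

lemma measureReal_lt_le_of_integral_le {Ω : Type*} [MeasurableSpace Ω] {P : Measure Ω}
    [IsProbabilityMeasure P] {f : Ω → ℝ} (hf : 0 ≤ f) (hfi : Integrable f P) {A k : ℝ}
    (hk : 0 < k) (hA : ∫ ω, f ω ∂P ≤ A) : P.real {ω | k * A < f ω} ≤ k⁻¹ := by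
  rcases (integral_nonneg hf).trans hA |>.eq_or_lt with h0 | hpos
  · have hae : f =ᵐ[P] 0 := (integral_eq_zero_iff_of_nonneg hf hfi).1
      (le_antisymm (hA.trans h0.ge) (integral_nonneg hf))
    have : P {ω | k * A < f ω} = 0 := by
      refine measure_mono_null (fun ω (hω : k * A < f ω) => ?_) hae
      rw [← h0, mul_zero] at hω
      exact hω.ne'
    rw [Measure.real, this]
    simpa using hk.le
  · have hM := (mul_meas_ge_le_integral_of_nonneg (.of_forall hf) hfi (k * A)).trans hA
    have hsub : P.real {ω | k * A < f ω} ≤ P.real {ω | k * A ≤ f ω} :=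
      measureReal_mono fun ω (hω : k * A < f ω) => hω.le
    refine hsub.trans ?_
    rw [← one_div, le_div_iff₀ hk]
    exact le_of_mul_le_mul_right (by linarith) hpos

/-- A transport plan between points at pairwise `ℓ₁`-distance at least `1` has, outside an event of
probability `1 / k`, quadtree cost within `4 * k * (M + 1)` of its `ℓ₁` cost. -/
lemma shiftMeasure_real_quadDist_cost_gt_le {d : ℕ} {M : ℤ} (hM : 0 ≤ M)
    {X : Finset (Fin d → ℝ)}
    (hsep : ∀ x ∈ X, ∀ y ∈ X, x ≠ y → 1 ≤ ∑ i, |x i - y i|)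
    {τ : (Fin d → ℝ) → (Fin d → ℝ) → ℝ} (hτ : ∀ a b, 0 ≤ τ a b) {k : ℝ} (hk : 0 < k) :
    (shiftMeasure d M).real {σ | k * (4 * (M + 1) * ∑ a ∈ X, ∑ b ∈ X, τ a b * ∑ j, |a j - b j|) <
      ∑ a ∈ X, ∑ b ∈ X, τ a b * quadDist d M σ a b} ≤ k⁻¹ := by
  have hMr : (0 : ℝ) ≤ M := by exact_mod_cast hM
  set g : (Fin d → ℝ) → (Fin d → ℝ) → (Fin d → ℝ) → ℝ := fun a b σ =>
    if a = b then 0 else 4 + 2 * ∑ ℓ ∈ Finset.Icc 1 M,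
      {σ | Separated d σ ℓ a b}.indicator (fun _ => (2 : ℝ) ^ ℓ) σ with hg
  have hind (ℓ : ℤ) (a b : Fin d → ℝ) : Integrable
      ({σ | Separated d σ ℓ a b}.indicator fun _ => (2 : ℝ) ^ ℓ) (shiftMeasure d M) :=
    (integrable_const _).indicator (measurableSet_separated d ℓ a b)
  have hsum (a b : Fin d → ℝ) : Integrable (fun σ => ∑ ℓ ∈ Finset.Icc 1 M,
      {σ | Separated d σ ℓ a b}.indicator (fun _ => (2 : ℝ) ^ ℓ) σ) (shiftMeasure d M) :=
    integrable_finsetSum _ fun ℓ _ => hind ℓ a b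
  have hgint (a b : Fin d → ℝ) : Integrable (g a b) (shiftMeasure d M) := by
    by_cases hab : a = b
    · simp [hg, hab]
    · simp only [hg, hab, if_false]
      exact (integrable_const (4 : ℝ)).add ((hsum a b).const_mul 2)
  have hgpos (a b σ : Fin d → ℝ) : 0 ≤ g a b σ := by
    simp only [hg]
    split_ifs
    · exact le_rfl
    · have := Finset.sum_nonneg fun ℓ (_ : ℓ ∈ Finset.Icc 1 M) =>
        Set.indicator_nonneg (s := {σ | Separated d σ ℓ a b})
          (f := fun _ => (2 : ℝ) ^ ℓ) (fun _ _ => by positivity) σ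
      linarith
  have hgle (a b σ : Fin d → ℝ) : quadDist d M σ a b ≤ g a b σ := by
    by_cases hab : a = b
    · simp [hg, hab, quadDist_self]
    · simpa only [hg, hab, if_false, Set.indicator, Set.mem_ofPred_eq] using quadDist_le M σ a b
  have hgval {a b : Fin d → ℝ} (ha : a ∈ X) (hb : b ∈ X) :
      ∫ σ, g a b σ ∂shiftMeasure d M ≤ 4 * (M + 1) * ∑ j, |a j - b j| := by
    by_cases hab : a = b
    · simp [hg, hab]
    · have hterm (ℓ : ℤ) (hℓ : ℓ ∈ Finset.Icc 1 M) :
          ∫ σ, {σ | Separated d σ ℓ a b}.indicator (fun _ => (2 : ℝ) ^ ℓ) σ ∂shiftMeasure d M ≤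
            ∑ j, |a j - b j| := by
        rw [integral_indicator_const _ (measurableSet_separated d ℓ a b), smul_eq_mul,
          ← le_div_iff₀ (by positivity)]
        exact shiftMeasure_real_separated_le (Finset.mem_Icc.1 hℓ).2 a b
      have htot := Finset.sum_le_sum hterm
      rw [Finset.sum_const, Int.card_Icc, nsmul_eq_mul] at htot
      have hcard : (((M + 1 - 1).toNat : ℕ) : ℝ) = M := by
        rw [add_sub_cancel_right]
        exact_mod_cast Int.toNat_of_nonneg hM
      rw [hcard] at htot
      simp only [hg, hab, if_false]
      rw [integral_add (integrable_const _) ((hsum a b).const_mul 2), integral_const_mul,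
        integral_finsetSum _ fun ℓ _ => hind ℓ a b]
      simp only [integral_const, probReal_univ, one_smul]
      nlinarith [hsep a ha b hb hab]
  have hfi : Integrable (fun σ => ∑ a ∈ X, ∑ b ∈ X, τ a b * g a b σ) (shiftMeasure d M) :=
    integrable_finsetSum _ fun a _ => integrable_finsetSum _ fun b _ => (hgint a b).const_mul _
  have hval : ∫ σ, ∑ a ∈ X, ∑ b ∈ X, τ a b * g a b σ ∂shiftMeasure d M ≤
      4 * (M + 1) * ∑ a ∈ X, ∑ b ∈ X, τ a b * ∑ j, |a j - b j| := by
    rw [integral_finsetSum _ fun a _ => integrable_finsetSum _ fun b _ =>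
      (hgint a b).const_mul _, Finset.mul_sum]
    refine Finset.sum_le_sum fun a ha => ?_
    rw [integral_finsetSum _ fun b _ => (hgint a b).const_mul _, Finset.mul_sum]
    refine Finset.sum_le_sum fun b hb => ?_
    rw [integral_const_mul]
    exact (mul_le_mul_of_nonneg_left (hgval ha hb) (hτ a b)).trans_eq (by ring)
  refine le_trans (measureReal_mono fun σ hσ => ?_) (measureReal_lt_le_of_integral_le
    (fun σ => Finset.sum_nonneg fun a _ => Finset.sum_nonneg fun b _ =>
      mul_nonneg (hτ a b) (hgpos a b σ)) hfi hk hval)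
  refine lt_of_lt_of_le (Set.mem_ofPred_eq ▸ hσ) ?_
  gcongr with a _ b _
  · exact hτ a b
  · exact hgle a b σ

/-- The quadtree distance contracts a given pair by more than a factor `K` with probability at most
`exp (-K)`. -/
lemma shiftMeasure_real_quadDist_lt_le {d : ℕ} {M : ℤ} {x y : Fin d → ℝ}
    (hdiam : ∑ i, |x i - y i| ≤ (2 : ℝ) ^ M) {K : ℝ} (hK : 1 ≤ K) :
    (shiftMeasure d M).real {σ | K * quadDist d M σ x y < ∑ i, |x i - y i|} ≤ Real.exp (-K) := by
  have hK0 : 0 < K := by linarith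
  rcases (Finset.sum_nonneg fun i (_ : i ∈ Finset.univ) => abs_nonneg (x i - y i)).eq_or_lt
    with h0 | hpos
  · have : {σ | K * quadDist d M σ x y < ∑ i, |x i - y i|} = ∅ := by
      refine Set.eq_empty_of_forall_notMem fun σ hσ => ?_
      have h1 : K * quadDist d M σ x y < ∑ i, |x i - y i| := hσ
      rw [← h0] at h1
      exact h1.not_ge (mul_nonneg hK0.le (quadDist_nonneg M σ x y))
    rw [this]
    simpa using (Real.exp_pos _).le
  set D := ∑ i, |x i - y i|
  set ℓ := Int.log 2 (D / K)
  have h1 : (2 : ℝ) ^ ℓ ≤ D / K := by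
    exact_mod_cast Int.zpow_log_le_self (b := 2) (by norm_num) (div_pos hpos hK0)
  have h2 : D / K < (2 : ℝ) ^ (ℓ + 1) := by
    exact_mod_cast Int.lt_zpow_succ_log_self (b := 2) (by norm_num) (D / K)
  have hℓ : ℓ ≤ M := (zpow_le_zpow_iff_right₀ (one_lt_two (α := ℝ))).1 <|
    h1.trans <| (div_le_self hpos.le hK).trans hdiam
  have hsub : {σ | K * quadDist d M σ x y < D} ⊆ {σ | ¬ Separated d σ ℓ x y} := by
    intro σ hσ hsep
    have h3 := le_quadDist_of_separated hℓ hsep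
    rw [zpow_add_one₀ two_ne_zero, div_lt_iff₀ hK0] at h2
    have h4 : K * quadDist d M σ x y < D := hσ
    nlinarith
  refine (measureReal_mono hsub).trans ((shiftMeasure_real_not_separated_le hℓ x y).trans ?_)
  refine Real.exp_le_exp.2 (neg_le_neg ?_)
  rwa [le_div_iff₀ (by positivity), ← le_div_iff₀' hK0]

/-- A cost comparison on the product of the supports transfers to the transport distances. -/
lemma wOn_le_mul_wOn {α : Type*} {X : Finset α} {μ ν : α → ℝ} {c c' : α → α → ℝ} {K : ℝ}
    (hc : ∀ a b, 0 ≤ c a b) (hc' : ∀ a b, 0 ≤ c' a b) (hμ : IsDistOn X μ) (hν : IsDistOn X ν)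
    (h : ∀ a b, μ a ≠ 0 → ν b ≠ 0 → c a b ≤ K * c' a b) :
    WOn X c μ ν ≤ K * WOn X c' μ ν := by
  obtain ⟨τ, hτ, hval⟩ := exists_isCouplingOn_eq_wOn hc' hμ hν
  refine (hτ.wOn_le hc).trans ?_
  rw [← hval]
  simp only [Finset.mul_sum]
  refine Finset.sum_le_sum fun a _ => Finset.sum_le_sum fun b _ => ?_
  rcases (hτ.1 a b).eq_or_lt with h0 | hpos
  · simp [← h0]
  · have := h a b (hpos.trans_le (hτ.le_left a b)).ne' (hpos.trans_le (hτ.le_right a b)).ne'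
    nlinarith

lemma IsDistOn.exists_ne_zero {α : Type*} {X : Finset α} {μ : α → ℝ} (h : IsDistOn X μ) :
    ∃ a ∈ X, μ a ≠ 0 :=
  Finset.exists_ne_zero_of_sum_ne_zero (by rw [h.2.2]; exact one_ne_zero)

/-- The pairs of a point of some `μ i` and a point of `ν`. -/
noncomputable def supportPairs {α : Type*} {n : ℕ} (X : Finset α) (μ : Fin n → α → ℝ) (ν : α → ℝ) :
    Finset (α × α) :=
  (Finset.univ.biUnion fun i => X.filter fun a => μ i a ≠ 0) ×ˢ X.filter fun a => ν a ≠ 0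

lemma card_supportPairs_le {α : Type*} {n s : ℕ} {X : Finset α} {μ : Fin n → α → ℝ} {ν : α → ℝ}
    (hn : 0 < n) (hμ : ∀ i, (X.filter fun a => μ i a ≠ 0).card ≤ s)
    (hν : (X.filter fun a => ν a ≠ 0).card ≤ s) :
    (supportPairs X μ ν).card ≤ (min (s * n) X.card) ^ 2 := by
  rw [supportPairs, Finset.card_product, sq]
  refine Nat.mul_le_mul (le_min ?_ ?_) (le_min ?_ ?_)
  · refine Finset.card_biUnion_le.trans ((Finset.sum_le_sum fun i _ => hμ i).trans_eq ?_)
    simp [mul_comm]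
  · exact Finset.card_le_card (Finset.biUnion_subset.2 fun i _ => Finset.filter_subset _ _)
  · exact hν.trans (Nat.le_mul_of_pos_right s hn)
  · exact Finset.card_filter_le _ _

lemma sq_mul_exp_neg_le {N : ℝ} (hN : 1 ≤ N) :
    N ^ 2 * Real.exp (-(6 * (1 + Real.log N))) ≤ 1 / 200 := by
  have hlog : 0 ≤ Real.log N := Real.log_nonneg hN
  have hN2 : N ^ 2 = Real.exp (2 * Real.log N) := by
    rw [two_mul, Real.exp_add, Real.exp_log (by linarith), sq]
  have h6 : (200 : ℝ) ≤ Real.exp 6 := by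
    have : Real.exp 6 = Real.exp 1 ^ 6 := by rw [← Real.exp_nat_mul]; norm_num
    rw [this]
    calc (200 : ℝ) ≤ 2.7 ^ 6 := by norm_num
      _ ≤ _ := by gcongr; linarith [Real.exp_one_gt_d9]
  calc N ^ 2 * Real.exp (-(6 * (1 + Real.log N)))
      = Real.exp (2 * Real.log N + -(6 * (1 + Real.log N))) := by rw [hN2, Real.exp_add]
    _ ≤ Real.exp (-6) := Real.exp_le_exp.2 (by linarith)
    _ = 1 / Real.exp 6 := by rw [Real.exp_neg, one_div]
    _ ≤ 1 / 200 := by gcongr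

/-- The Quadtree nearest-neighbor guarantee: with probability at least 0.99 over the
random shift `σ`, the nearest neighbor of `ν` among `μ₁, …, μ_n` in the Quadtree
Wasserstein distance `W_{T_σ}` is an
`O(log(min(sn,|X|))·log(dΦ))`-approximate nearest neighbor in `W₁`
(here `Φ = 2^M` and the `log(dΦ)` factor is realized as `M+1` levels). -/
theorem stmt8 : ∃ C : ℝ, 0 < C ∧
    ∀ (d s n : ℕ) (M : ℤ), 0 ≤ M →
    ∀ X : Finset (Fin d → ℝ),
      (∀ x ∈ X, ∀ i, 0 ≤ x i ∧ x i ≤ (2 : ℝ) ^ M) →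
      (∀ x ∈ X, ∀ y ∈ X, x ≠ y → 1 ≤ ∑ i, |x i - y i|) →
      (∀ x ∈ X, ∀ y ∈ X, ∑ i, |x i - y i| ≤ (2 : ℝ) ^ M) →
    ∀ (μ : Fin n → (Fin d → ℝ) → ℝ) (ν : (Fin d → ℝ) → ℝ),
      (∀ i, IsDistOn X (μ i)) → IsDistOn X ν →
      (∀ i, (X.filter fun a => μ i a ≠ 0).card ≤ s) →
      (X.filter fun a => ν a ≠ 0).card ≤ s →
    ENNReal.ofReal 0.99 ≤
      (Measure.pi fun _ : Fin d => unif ((2 : ℝ) ^ M))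
        {σ : Fin d → ℝ | ∀ i' : Fin n,
          (∀ i, WOn X (quadDist d M σ) (μ i') ν ≤ WOn X (quadDist d M σ) (μ i) ν) →
          ∀ i, WOn X (fun a b => ∑ j, |a j - b j|) (μ i') ν ≤
            C * (1 + Real.log (min ((s : ℝ) * (n : ℝ)) (X.card : ℝ))) * ((M : ℝ) + 1) *
              WOn X (fun a b => ∑ j, |a j - b j|) (μ i) ν} := by
  refine ⟨4800, by norm_num, ?_⟩
  intro d s n M hM X _ hsep hdiam μ ν hμ hν hμs hνs
  set c : (Fin d → ℝ) → (Fin d → ℝ) → ℝ := fun a b => ∑ j, |a j - b j|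
  have hc (a b : Fin d → ℝ) : 0 ≤ c a b := Finset.sum_nonneg fun j _ => abs_nonneg _
  rcases Nat.eq_zero_or_pos n with rfl | hn
  · exact (ENNReal.ofReal_le_one.2 (by norm_num)).trans <|
      (measure_univ (μ := shiftMeasure d M)).symm.trans_le (measure_mono fun σ _ i => i.elim0)
  have : Nonempty (Fin n) := ⟨⟨0, hn⟩⟩
  obtain ⟨i₀, hi₀⟩ := Finite.exists_min fun i => WOn X c (μ i) ν
  obtain ⟨τ, hτ, hτval⟩ := exists_isCouplingOn_eq_wOn hc (hμ i₀) hν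
  have hW0 : 0 ≤ WOn X c (μ i₀) ν := hτval ▸
    Finset.sum_nonneg fun a _ => Finset.sum_nonneg fun b _ => mul_nonneg (hτ.1 a b) (hc a b)
  obtain ⟨x₀, hx₀, hνx₀⟩ := hν.exists_ne_zero
  have hs : 0 < s := (Finset.card_pos.2 ⟨x₀, Finset.mem_filter.2 ⟨hx₀, hνx₀⟩⟩).trans_le hνs
  have hNcast : ((min (s * n) X.card : ℕ) : ℝ) = min ((s : ℝ) * n) X.card := by push_cast; rfl
  have hN1 : (1 : ℝ) ≤ min ((s : ℝ) * n) X.card := by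
    rw [← hNcast]
    exact_mod_cast le_min (Nat.mul_pos hs hn) (Finset.card_pos.2 ⟨x₀, hx₀⟩)
  set N : ℝ := min ((s : ℝ) * n) X.card
  have hlog : 0 ≤ Real.log N := Real.log_nonneg hN1
  set K : ℝ := 6 * (1 + Real.log N) with hK
  have hMr : (0 : ℝ) ≤ M := by exact_mod_cast hM
  set B₁ : Set (Fin d → ℝ) := {σ | 200 * (4 * (M + 1) * ∑ a ∈ X, ∑ b ∈ X, τ a b * c a b) <
    ∑ a ∈ X, ∑ b ∈ X, τ a b * quadDist d M σ a b}
  set B₂ : Set (Fin d → ℝ) := ⋃ p ∈ supportPairs X μ ν, {σ | K * quadDist d M σ p.1 p.2 < c p.1 p.2}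
  have hB₁ : (shiftMeasure d M).real B₁ ≤ 1 / 200 := by
    rw [one_div]
    exact shiftMeasure_real_quadDist_cost_gt_le hM hsep hτ.1 (by norm_num)
  have hB₂ : (shiftMeasure d M).real B₂ ≤ 1 / 200 := by
    refine (measureReal_biUnion_finset_le _ _).trans ?_
    calc _ ≤ ∑ p ∈ supportPairs X μ ν, Real.exp (-K) := by
          refine Finset.sum_le_sum fun p hp => ?_
          simp only [supportPairs, Finset.mem_product, Finset.mem_biUnion, Finset.mem_filter] at hp
          obtain ⟨⟨i, -, hp1, -⟩, hp2, -⟩ := hp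
          exact shiftMeasure_real_quadDist_lt_le (hdiam _ hp1 _ hp2) (by linarith)
      _ = ((supportPairs X μ ν).card : ℝ) * Real.exp (-K) := by rw [Finset.sum_const, nsmul_eq_mul]
      _ ≤ N ^ 2 * Real.exp (-K) := by
          gcongr
          rw [← hNcast]
          exact_mod_cast card_supportPairs_le hn hμs hνs
      _ ≤ 1 / 200 := sq_mul_exp_neg_le hN1
  set G : Set (Fin d → ℝ) := {σ : Fin d → ℝ | ∀ i' : Fin n,
    (∀ i, WOn X (quadDist d M σ) (μ i') ν ≤ WOn X (quadDist d M σ) (μ i) ν) →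
      ∀ i, WOn X c (μ i') ν ≤ 4800 * (1 + Real.log N) * ((M : ℝ) + 1) * WOn X c (μ i) ν}
  have hgood : (Set.univ : Set (Fin d → ℝ)) ⊆ G ∪ (B₁ ∪ B₂) := by
    intro σ _
    by_contra hσ
    simp only [Set.mem_union, not_or] at hσ
    obtain ⟨hG, h1, h2⟩ := hσ
    refine hG fun i' hi' i => ?_
    have hcontract : WOn X c (μ i') ν ≤ K * WOn X (quadDist d M σ) (μ i') ν := by
      refine wOn_le_mul_wOn hc (quadDist_nonneg M σ) (hμ i') hν fun a b ha hb => ?_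
      by_contra! hlt
      refine h2 (Set.mem_biUnion (x := (a, b)) ?_ hlt)
      simp only [supportPairs, Finset.coe_product, Set.mem_prod, Finset.mem_coe,
        Finset.mem_biUnion, Finset.mem_filter]
      exact ⟨⟨i', Finset.mem_univ _, (hμ i').2.1 a ha, ha⟩, hν.2.1 b hb, hb⟩
    have hexpand : WOn X (quadDist d M σ) (μ i₀) ν ≤
        200 * (4 * (M + 1) * WOn X c (μ i₀) ν) := by
      rw [← hτval]
      exact (hτ.wOn_le (quadDist_nonneg M σ)).trans (not_lt.1 h1)
    calc WOn X c (μ i') ν ≤ K * (200 * (4 * (M + 1) * WOn X c (μ i₀) ν)) :=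
          hcontract.trans (mul_le_mul_of_nonneg_left ((hi' i₀).trans hexpand) (by linarith))
      _ = 4800 * (1 + Real.log N) * (M + 1) * WOn X c (μ i₀) ν := by rw [hK]; ring
      _ ≤ 4800 * (1 + Real.log N) * (M + 1) * WOn X c (μ i) ν := by gcongr; exact hi₀ i
  have htotal : 1 ≤ (shiftMeasure d M).real G + (1 / 200 + 1 / 200) := by
    calc (1 : ℝ) = (shiftMeasure d M).real Set.univ := probReal_univ.symm
      _ ≤ (shiftMeasure d M).real (G ∪ (B₁ ∪ B₂)) := measureReal_mono hgood
      _ ≤ _ := (measureReal_union_le _ _).trans (by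
          gcongr
          exact (measureReal_union_le _ _).trans (add_le_add hB₁ hB₂))
  rw [ENNReal.ofReal_le_iff_le_toReal (measure_ne_top _ _)]
  change _ ≤ (shiftMeasure d M).real G
  linarith
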